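/- arXiv:1203.1569 — 2 statements merged into one kernel-verified Lean document; each statement's English description precedes it below -/
import Mathlib

section
/- For every SPARQL expression P, the SPARQL_LD query Q^P (the Linked Data query defined by Q^P(W) = ⟦P⟧_{AllData(W)}) is nontrivially satisfiable if and only if P is nontrivially satisfiable. -/
/-! Basic vocabulary: pairwise disjoint countably infinite sets of URIs,
blank nodes, literals and variables (realized as constructors of sum-like
inductive types over `ℕ`). -/

abbrev URI := ℕ
abbrev BNode := ℕ
abbrev Lit := ℕ
abbrev Var := ℕ
abbrev Doc := ℕ

/-- RDF terms: elements of U ∪ B ∪ L (pairwise disjoint). -/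
inductive Term
  | uri (u : URI)
  | bnode (b : BNode)
  | lit (l : Lit)

/-- Elements of U ∪ B (possible subjects of RDF triples). -/
inductive Node
  | uri (u : URI)
  | bnode (b : BNode)

def Node.toTerm : Node → Term
  | .uri u => .uri u
  | .bnode b => .bnode b

/-- An RDF triple (s,p,o) ∈ (U ∪ B) × U × (U ∪ B ∪ L). -/
structure RDFTriple where
  s : Node
  p : URI
  o : Term

/-- The RDF terms mentioned in a triple. -/
def RDFTriple.terms (t : RDFTriple) : Set Term :=
  {t.s.toTerm, Term.uri t.p, t.o}

/-- The URIs mentioned in a triple. -/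
def RDFTriple.uris (t : RDFTriple) : Set URI :=
  {u | Term.uri u ∈ t.terms}

/-- The blank nodes mentioned in a set of triples. -/
def bnodesOf (G : Set RDFTriple) : Set BNode :=
  {b | ∃ t ∈ G, Term.bnode b ∈ RDFTriple.terms t}

/-- Subject/predicate position of a triple pattern: V ∪ U. -/
inductive PatSP
  | var (v : Var)
  | uri (u : URI)

/-- Object position of a triple pattern: V ∪ U ∪ L. -/
inductive PatO
  | var (v : Var)
  | uri (u : URI)
  | lit (l : Lit)

/-- A triple pattern: an element of (V ∪ U) × (V ∪ U) × (V ∪ U ∪ L). -/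
structure TriplePattern where
  s : PatSP
  p : PatSP
  o : PatO

def PatSP.vars : PatSP → Set Var
  | .var v => {v}
  | .uri _ => ∅

def PatO.vars : PatO → Set Var
  | .var v => {v}
  | .uri _ => ∅
  | .lit _ => ∅

/-- vars(tp): the variables of a triple pattern. -/
def TriplePattern.vars (tp : TriplePattern) : Set Var :=
  tp.s.vars ∪ tp.p.vars ∪ tp.o.vars

/-- A valuation: a partial map V → U ∪ B ∪ L. -/
def Valu := Var → Option Term

/-- The domain of a valuation. -/
def Valu.dom (μ : Valu) : Set Var := {v | μ v ≠ none}

/-- Two valuations are compatible if they agree on the intersection of their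
domains. -/
def Valu.Compatible (μ1 μ2 : Valu) : Prop :=
  ∀ v t1 t2, μ1 v = some t1 → μ2 v = some t2 → t1 = t2

/-- Union of two (compatible) valuations. -/
def Valu.union (μ1 μ2 : Valu) : Valu :=
  fun v => (μ1 v).orElse (fun _ => μ2 v)

def PatSP.applyS (μ : Valu) : PatSP → Option Node
  | .uri u => some (.uri u)
  | .var v =>
      match μ v with
      | some (.uri u) => some (.uri u)
      | some (.bnode b) => some (.bnode b)
      | _ => none

def PatSP.applyP (μ : Valu) : PatSP → Option URI
  | .uri u => some u
  | .var v =>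
      match μ v with
      | some (.uri u) => some u
      | _ => none

def PatO.applyO (μ : Valu) : PatO → Option Term
  | .uri u => some (.uri u)
  | .lit l => some (.lit l)
  | .var v => μ v

/-- μ[tp]: the RDF triple obtained by applying μ to tp (defined only when all
variables of tp are bound by μ to terms of appropriate kinds). -/
def TriplePattern.apply (μ : Valu) (tp : TriplePattern) : Option RDFTriple :=
  match tp.s.applyS μ, tp.p.applyP μ, tp.o.applyO μ with
  | some s, some p, some o => some ⟨s, p, o⟩
  | _, _, _ => none

/-- Constants allowed in filter conditions: U ∪ L. -/
inductive Const
  | uri (u : URI)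
  | lit (l : Lit)

def Const.toTerm : Const → Term
  | .uri u => .uri u
  | .lit l => .lit l

/-- Filter conditions, built from atoms ?x = c, ?x = ?y, bound(?x)
using ¬, ∧, ∨. -/
inductive FilterCond
  | eqConst (v : Var) (c : Const)
  | eqVar (v1 v2 : Var)
  | bound (v : Var)
  | not (R : FilterCond)
  | and (R1 R2 : FilterCond)
  | or (R1 R2 : FilterCond)

/-- μ satisfies a filter condition R. -/
def FilterCond.Satisfies : FilterCond → Valu → Prop
  | .eqConst v c, μ => μ v = some c.toTerm
  | .eqVar v1 v2, μ => ∃ t, μ v1 = some t ∧ μ v2 = some t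
  | .bound v, μ => μ v ≠ none
  | .not R, μ => ¬ FilterCond.Satisfies R μ
  | .and R1 R2, μ => FilterCond.Satisfies R1 μ ∧ FilterCond.Satisfies R2 μ
  | .or R1 R2, μ => FilterCond.Satisfies R1 μ ∨ FilterCond.Satisfies R2 μ

/-- SPARQL expressions. -/
inductive SparqlExpr
  | pat (tp : TriplePattern)
  | andE (P1 P2 : SparqlExpr)
  | unionE (P1 P2 : SparqlExpr)
  | optE (P1 P2 : SparqlExpr)
  | filterE (P : SparqlExpr) (R : FilterCond)

/-- ⟦P⟧_G : the evaluation of a SPARQL expression P over a (possibly infinite)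
set G of RDF triples. -/
def eval : SparqlExpr → Set RDFTriple → Set Valu
  | .pat tp, G =>
      {μ | Valu.dom μ = tp.vars ∧ ∃ t ∈ G, TriplePattern.apply μ tp = some t}
  | .andE P1 P2, G =>
      {μ | ∃ μ1 ∈ eval P1 G, ∃ μ2 ∈ eval P2 G,
        Valu.Compatible μ1 μ2 ∧ μ = Valu.union μ1 μ2}
  | .unionE P1 P2, G => eval P1 G ∪ eval P2 G
  | .optE P1 P2, G =>
      {μ | ∃ μ1 ∈ eval P1 G, ∃ μ2 ∈ eval P2 G,
        Valu.Compatible μ1 μ2 ∧ μ = Valu.union μ1 μ2} ∪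
      {μ1 | μ1 ∈ eval P1 G ∧ ∀ μ2 ∈ eval P2 G, ¬ Valu.Compatible μ1 μ2}
  | .filterE P R, G => {μ | μ ∈ eval P G ∧ FilterCond.Satisfies R μ}

/-- P is satisfiable: ⟦P⟧_G ≠ ∅ for some set G of RDF triples. -/
def SparqlExpr.Satisfiable (P : SparqlExpr) : Prop :=
  ∃ G : Set RDFTriple, (eval P G).Nonempty

/-- P is nontrivially satisfiable: some solution binds at least one variable. -/
def SparqlExpr.NontriviallySatisfiable (P : SparqlExpr) : Prop :=
  ∃ G : Set RDFTriple, ∃ μ ∈ eval P G, Valu.dom μ ≠ ∅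

/-- P is monotonic: G1 ⊆ G2 implies ⟦P⟧_{G1} ⊆ ⟦P⟧_{G2}. -/
def SparqlExpr.Monotonic (P : SparqlExpr) : Prop :=
  ∀ G1 G2 : Set RDFTriple, G1 ⊆ G2 → eval P G1 ⊆ eval P G2

/-- A Web of Linked Data W = (D, data, adoc): D a countable set of LD documents
(subsets of ℕ are countable), data assigns to each document a finite set of
RDF triples (distinct documents using disjoint sets of blank nodes), and adoc
is a partial surjective map from URIs to D. -/
structure Web where
  D : Set Doc
  data : Doc → Set RDFTriple
  adoc : URI → Option Doc
  data_fin : ∀ d ∈ D, (data d).Finite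
  bnode_disj : ∀ d1 ∈ D, ∀ d2 ∈ D, d1 ≠ d2 →
    Disjoint (bnodesOf (data d1)) (bnodesOf (data d2))
  adoc_mem : ∀ u d, adoc u = some d → d ∈ D
  adoc_surj : ∀ d ∈ D, ∃ u, adoc u = some d

/-- AllData(W) = ⋃_{d ∈ D} data(d). -/
def Web.AllData (W : Web) : Set RDFTriple := ⋃ d ∈ W.D, W.data d

/-- A Web of Linked Data is finite iff its set of documents is finite. -/
def Web.IsFinite (W : Web) : Prop := W.D.Finite

/-- W1 is an induced subweb of W2. -/
def InducedSubweb (W1 W2 : Web) : Prop :=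
  W1.D ⊆ W2.D ∧ (∀ d ∈ W1.D, W1.data d = W2.data d) ∧
  ∀ u d, W1.adoc u = some d ↔ (W2.adoc u = some d ∧ d ∈ W1.D)

/-- A Linked Data query: a function from Webs of Linked Data to sets of
valuations. -/
def LDQuery := Web → Set Valu

def LDQuery.Satisfiable (q : LDQuery) : Prop := ∃ W, (q W).Nonempty

def LDQuery.NontriviallySatisfiable (q : LDQuery) : Prop :=
  ∃ W, ∃ μ ∈ q W, Valu.dom μ ≠ ∅

def LDQuery.Monotonic (q : LDQuery) : Prop :=
  ∀ W1 W2, InducedSubweb W1 W2 → q W1 ⊆ q W2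

/-- The SPARQL_LD (full-Web semantics) query Q^P. -/
def fullWebQuery (P : SparqlExpr) : LDQuery := fun W => eval P (Web.AllData W)

/-- A reachability criterion. -/
def ReachCrit := RDFTriple → URI → SparqlExpr → Bool

/-- c_None : the reachability criterion that always returns false. -/
def cNone : ReachCrit := fun _ _ _ => false

/-- c1 is less restrictive than c2. -/
def LessRestrictive (c1 c2 : ReachCrit) : Prop :=
  ∀ t u P, c2 t u P = true → c1 t u P = true

/-- A document d is (c,P)-reachable from S in W. -/
inductive Reachable (W : Web) (S : Set URI) (c : ReachCrit) (P : SparqlExpr) : Doc → Prop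
  | seed {u : URI} {d : Doc} (hu : u ∈ S) (ha : W.adoc u = some d) :
      Reachable W S c P d
  | step {d' : Doc} {t : RDFTriple} {u : URI} {d : Doc}
      (hr : Reachable W S c P d') (ht : t ∈ W.data d') (hu : u ∈ RDFTriple.uris t)
      (hc : c t u P = true) (ha : W.adoc u = some d) :
      Reachable W S c P d

lemma Reachable.mem_D {W : Web} {S : Set URI} {c : ReachCrit} {P : SparqlExpr}
    {d : Doc} (h : Reachable W S c P d) : d ∈ W.D := by
  cases h with
  | seed hu ha => exact W.adoc_mem _ _ ha
  | step hr ht hu hc ha => exact W.adoc_mem _ _ ha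

lemma Reachable.exists_uri {W : Web} {S : Set URI} {c : ReachCrit} {P : SparqlExpr}
    {d : Doc} (h : Reachable W S c P d) : ∃ u, W.adoc u = some d := by
  cases h with
  | seed hu ha => exact ⟨_, ha⟩
  | step hr ht hu hc ha => exact ⟨_, ha⟩

open Classical in
/-- The restriction of adoc to URIs whose document lies in `Ds`. -/
noncomputable def restrictAdoc (W : Web) (Ds : Set Doc) : URI → Option Doc :=
  fun u => if (∃ d ∈ Ds, W.adoc u = some d) then W.adoc u else none

lemma restrictAdoc_eq_some (W : Web) (Ds : Set Doc) (u : URI) (d : Doc) :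
    restrictAdoc W Ds u = some d ↔ W.adoc u = some d ∧ d ∈ Ds := by
  unfold restrictAdoc
  split
  · rename_i h
    obtain ⟨d', hd', ha⟩ := h
    constructor
    · intro he
      obtain rfl : d = d' := Option.some.inj (he.symm.trans ha)
      exact ⟨he, hd'⟩
    · exact fun h => h.1
  · rename_i h
    push_neg at h
    constructor
    · intro he; cases he
    · rintro ⟨he, hd⟩
      exact (h d hd he).elim

/-- The (S,c,P)-reachable part of W: the induced subweb of W whose documents
are exactly those (c,P)-reachable from S in W. -/
noncomputable def reachablePart (W : Web) (S : Set URI) (c : ReachCrit)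
    (P : SparqlExpr) : Web where
  D := {d | Reachable W S c P d}
  data := W.data
  adoc := restrictAdoc W {d | Reachable W S c P d}
  data_fin := fun d hd => W.data_fin d (Reachable.mem_D hd)
  bnode_disj := fun d1 h1 d2 h2 hne =>
    W.bnode_disj d1 (Reachable.mem_D h1) d2 (Reachable.mem_D h2) hne
  adoc_mem := fun u d h => ((restrictAdoc_eq_some W _ u d).mp h).2
  adoc_surj := fun d hd => by
    obtain ⟨u, hu⟩ := Reachable.exists_uri hd
    exact ⟨u, (restrictAdoc_eq_some W _ u d).mpr ⟨hu, hd⟩⟩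

/-- The SPARQL_LD(R) (reachability-based semantics) query Q^{P,S,c}. -/
def reachQuery (P : SparqlExpr) (S : Set URI) (c : ReachCrit) : LDQuery :=
  fun W => eval P (Web.AllData (reachablePart W S c P))

/-- A reachability criterion ensures finiteness if every reachable part
(w.r.t. a finite seed set) has finitely many documents. -/
def EnsuresFiniteness (c : ReachCrit) : Prop :=
  ∀ (W : Web) (S : Set URI), S.Finite → ∀ P : SparqlExpr,
    (reachablePart W S c P).D.Finite

/-! Blank nodes can be traded for fresh URIs by an injective renaming of terms that fixes the
constants of an expression; evaluation commutes with this renaming, and any set of triples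
without blank nodes is the data of some Web of Linked Data. -/

/-- Rename terms injectively, eliminating blank nodes, fixing literals and all URIs below `N`. -/
def Term.skolem (N : ℕ) : Term → Term
  | .uri u => .uri (if u < N then u else 2 * u)
  | .bnode b => .uri (2 * (b + N) + 1)
  | .lit l => .lit l

lemma Term.skolem_injective (N : ℕ) : Function.Injective (Term.skolem N) := by
  rintro (a | a | a) (b | b | b) h <;> simp only [Term.skolem, Term.uri.injEq, Term.lit.injEq,
    Term.bnode.injEq, reduceCtorEq] at h ⊢ <;> grind

lemma Term.skolem_uri {N u : ℕ} (h : u < N) : Term.skolem N (.uri u) = .uri u := by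
  simp [Term.skolem, h]

lemma Term.skolem_ne_bnode (N : ℕ) (t : Term) (b : BNode) : t.skolem N ≠ .bnode b := by
  cases t <;> simp [Term.skolem]

def Node.skolem (N : ℕ) : Node → Node
  | .uri u => .uri (if u < N then u else 2 * u)
  | .bnode b => .uri (2 * (b + N) + 1)

lemma Node.toTerm_skolem (N : ℕ) (n : Node) : (n.skolem N).toTerm = n.toTerm.skolem N := by
  cases n <;> rfl

lemma Node.toTerm_injective : Function.Injective Node.toTerm := by
  rintro (a | a) (b | b) h <;> simp_all [Node.toTerm]

def RDFTriple.skolem (N : ℕ) (t : RDFTriple) : RDFTriple :=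
  ⟨t.s.skolem N, if t.p < N then t.p else 2 * t.p, t.o.skolem N⟩

lemma bnodesOf_image_skolem (N : ℕ) (G : Set RDFTriple) :
    bnodesOf (RDFTriple.skolem N '' G) = ∅ := by
  refine Set.eq_empty_iff_forall_notMem.mpr ?_
  rintro b ⟨_, ⟨t, -, rfl⟩, h⟩
  simp only [RDFTriple.terms, RDFTriple.skolem, Node.toTerm_skolem, Set.mem_insert_iff,
    Set.mem_singleton_iff, reduceCtorEq, false_or] at h
  exact h.elim (fun h => Term.skolem_ne_bnode _ _ _ h.symm)
    (fun h => Term.skolem_ne_bnode _ _ _ h.symm)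

/-- The term denoted by a subject or predicate pattern under a valuation. -/
def PatSP.applyTerm (μ : Valu) : PatSP → Option Term
  | .uri u => some (.uri u)
  | .var v => μ v

lemma PatSP.applyS_eq_some {μ : Valu} {x : PatSP} {n : Node} :
    x.applyS μ = some n ↔ x.applyTerm μ = some n.toTerm := by
  rcases x with v | u
  · rcases h : μ v with _ | (a | a | a) <;> cases n <;>
      simp [PatSP.applyS, PatSP.applyTerm, h, Node.toTerm]
  · cases n <;> simp [PatSP.applyS, PatSP.applyTerm, Node.toTerm]

lemma PatSP.applyP_eq_some {μ : Valu} {x : PatSP} {u : URI} :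
    x.applyP μ = some u ↔ x.applyTerm μ = some (.uri u) := by
  rcases x with v | u
  · rcases h : μ v with _ | (a | a | a) <;> simp [PatSP.applyP, PatSP.applyTerm, h]
  · simp [PatSP.applyP, PatSP.applyTerm]

lemma TriplePattern.apply_eq_some {μ : Valu} {tp : TriplePattern} {t : RDFTriple} :
    tp.apply μ = some t ↔ tp.s.applyTerm μ = some t.s.toTerm ∧
      tp.p.applyTerm μ = some (.uri t.p) ∧ tp.o.applyO μ = some t.o := by
  rw [← PatSP.applyS_eq_some, ← PatSP.applyP_eq_some]
  obtain ⟨s, p, o⟩ := t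
  unfold TriplePattern.apply
  split
  · simp_all
  · rename_i h
    simp only [reduceCtorEq, false_iff]
    rintro ⟨h1, h2, h3⟩
    exact h _ _ _ h1 h2 h3

def Valu.skolem (N : ℕ) (μ : Valu) : Valu := fun v => (μ v).map (Term.skolem N)

lemma Valu.dom_skolem (N : ℕ) (μ : Valu) : (μ.skolem N).dom = μ.dom := by
  ext v
  simp [Valu.dom, Valu.skolem]

lemma Valu.skolem_eq_some {N : ℕ} {μ : Valu} {v : Var} {t : Term} :
    μ.skolem N v = some (t.skolem N) ↔ μ v = some t := by
  simp only [Valu.skolem, Option.map_eq_some_iff]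
  exact ⟨fun ⟨a, h, e⟩ => Term.skolem_injective N e ▸ h, fun h => ⟨t, h, rfl⟩⟩

lemma Valu.compatible_skolem {N : ℕ} {μ1 μ2 : Valu} :
    Valu.Compatible (μ1.skolem N) (μ2.skolem N) ↔ Valu.Compatible μ1 μ2 := by
  constructor
  · intro h v t1 t2 h1 h2
    exact Term.skolem_injective N
      (h v _ _ (Valu.skolem_eq_some.mpr h1) (Valu.skolem_eq_some.mpr h2))
  · intro h v t1 t2 h1 h2
    obtain ⟨a, ha, rfl⟩ := Option.map_eq_some_iff.mp h1
    obtain ⟨b, hb, rfl⟩ := Option.map_eq_some_iff.mp h2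
    rw [h v a b ha hb]

lemma Valu.skolem_union (N : ℕ) (μ1 μ2 : Valu) :
    (Valu.union μ1 μ2).skolem N = Valu.union (μ1.skolem N) (μ2.skolem N) := by
  funext v
  rcases h : μ1 v with _ | a <;> simp [Valu.union, Valu.skolem, h]

/-- Strict upper bounds for the URIs mentioned in patterns, filter conditions and expressions. -/
def PatSP.uriBound : PatSP → ℕ
  | .var _ => 0
  | .uri u => u + 1

def PatO.uriBound : PatO → ℕ
  | .uri u => u + 1
  | _ => 0

def FilterCond.uriBound : FilterCond → ℕ
  | .eqConst _ (.uri u) => u + 1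
  | .eqConst _ (.lit _) => 0
  | .eqVar _ _ => 0
  | .bound _ => 0
  | .not R => R.uriBound
  | .and R1 R2 => max R1.uriBound R2.uriBound
  | .or R1 R2 => max R1.uriBound R2.uriBound

def SparqlExpr.uriBound : SparqlExpr → ℕ
  | .pat tp => max tp.s.uriBound (max tp.p.uriBound tp.o.uriBound)
  | .andE P1 P2 => max P1.uriBound P2.uriBound
  | .unionE P1 P2 => max P1.uriBound P2.uriBound
  | .optE P1 P2 => max P1.uriBound P2.uriBound
  | .filterE P R => max P.uriBound R.uriBound

lemma PatSP.applyTerm_skolem {N : ℕ} {μ : Valu} {x : PatSP} (hx : x.uriBound ≤ N) {t : Term} :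
    x.applyTerm (μ.skolem N) = some (t.skolem N) ↔ x.applyTerm μ = some t := by
  rcases x with v | u
  · exact Valu.skolem_eq_some
  · simp only [PatSP.applyTerm, Option.some.injEq]
    rw [← Term.skolem_uri (N := N) hx, (Term.skolem_injective N).eq_iff, Term.skolem_uri hx]

lemma PatO.applyO_skolem {N : ℕ} {μ : Valu} {x : PatO} (hx : x.uriBound ≤ N) {t : Term} :
    x.applyO (μ.skolem N) = some (t.skolem N) ↔ x.applyO μ = some t := by
  rcases x with v | u | l
  · exact Valu.skolem_eq_some
  · simp only [PatO.applyO, Option.some.injEq]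
    rw [← Term.skolem_uri (N := N) hx, (Term.skolem_injective N).eq_iff, Term.skolem_uri hx]
  · simp only [PatO.applyO, Option.some.injEq]
    exact (Term.skolem_injective N).eq_iff (a := Term.lit l)

lemma TriplePattern.apply_skolem {N : ℕ} {μ : Valu} {tp : TriplePattern}
    (h : (SparqlExpr.pat tp).uriBound ≤ N) {t : RDFTriple} :
    tp.apply (μ.skolem N) = some (t.skolem N) ↔ tp.apply μ = some t := by
  simp only [SparqlExpr.uriBound, max_le_iff] at h
  rw [TriplePattern.apply_eq_some, TriplePattern.apply_eq_some]
  simp only [RDFTriple.skolem, Node.toTerm_skolem]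
  rw [PatSP.applyTerm_skolem h.1, PatO.applyO_skolem h.2.2,
    ← PatSP.applyTerm_skolem (t := .uri t.p) h.2.1]
  rfl

lemma FilterCond.satisfies_skolem {N : ℕ} {μ : Valu} {R : FilterCond} (h : R.uriBound ≤ N) :
    R.Satisfies (μ.skolem N) ↔ R.Satisfies μ := by
  induction R with
  | eqConst v c =>
    rcases c with u | l
    · simp only [FilterCond.Satisfies, Const.toTerm]
      rw [← Valu.skolem_eq_some (N := N) (μ := μ), Term.skolem_uri h]
    · exact Valu.skolem_eq_some (t := .lit l)
  | eqVar v1 v2 =>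
    constructor
    · rintro ⟨t, h1, h2⟩
      obtain ⟨a, ha, rfl⟩ := Option.map_eq_some_iff.mp h1
      exact ⟨a, ha, Valu.skolem_eq_some.mp h2⟩
    · rintro ⟨t, h1, h2⟩
      exact ⟨_, Valu.skolem_eq_some.mpr h1, Valu.skolem_eq_some.mpr h2⟩
  | bound v => simp [FilterCond.Satisfies, Valu.skolem]
  | not R ih => exact not_congr (ih h)
  | and R1 R2 ih1 ih2 =>
    exact and_congr (ih1 (le_of_max_le_left h)) (ih2 (le_of_max_le_right h))
  | or R1 R2 ih1 ih2 =>
    exact or_congr (ih1 (le_of_max_le_left h)) (ih2 (le_of_max_le_right h))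

/-- A solution of a triple pattern over renamed triples is itself a renamed valuation. -/
lemma Valu.exists_skolem_eq {N : ℕ} {ν : Valu} {tp : TriplePattern} {t : RDFTriple}
    (hdom : ν.dom = tp.vars) (h : tp.apply ν = some (t.skolem N)) :
    ∃ μ : Valu, μ.skolem N = ν := by
  suffices H : ∀ v, ∃ o : Option Term, o.map (Term.skolem N) = ν v by
    choose μ hμ using H
    exact ⟨μ, funext hμ⟩
  intro v
  by_cases hv : v ∈ ν.dom
  · rw [hdom] at hv
    obtain ⟨h1, h2, h3⟩ := TriplePattern.apply_eq_some.mp h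
    rw [RDFTriple.skolem, Node.toTerm_skolem] at h1
    obtain ⟨s, p, o⟩ := tp
    rcases hv with (hv | hv) | hv
    · cases s with
      | uri u => exact hv.elim
      | var w => obtain rfl : v = w := hv; exact ⟨some t.s.toTerm, h1.symm⟩
    · cases p with
      | uri u => exact hv.elim
      | var w => obtain rfl : v = w := hv; exact ⟨some (.uri t.p), h2.symm⟩
    · cases o with
      | uri u => exact hv.elim
      | lit l => exact hv.elim
      | var w => obtain rfl : v = w := hv; exact ⟨some t.o, h3.symm⟩
  · exact ⟨none, (not_not.mp hv).symm⟩

lemma image_skolem_join (N : ℕ) (A B : Set Valu) :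
    {μ | ∃ μ1 ∈ Valu.skolem N '' A, ∃ μ2 ∈ Valu.skolem N '' B,
      Valu.Compatible μ1 μ2 ∧ μ = Valu.union μ1 μ2} =
    Valu.skolem N '' {μ | ∃ μ1 ∈ A, ∃ μ2 ∈ B,
      Valu.Compatible μ1 μ2 ∧ μ = Valu.union μ1 μ2} := by
  ext ν
  constructor
  · rintro ⟨_, ⟨μ1, h1, rfl⟩, _, ⟨μ2, h2, rfl⟩, hc, rfl⟩
    exact ⟨_, ⟨μ1, h1, μ2, h2, Valu.compatible_skolem.mp hc, rfl⟩, Valu.skolem_union ..⟩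
  · rintro ⟨_, ⟨μ1, h1, μ2, h2, hc, rfl⟩, rfl⟩
    exact ⟨_, ⟨μ1, h1, rfl⟩, _, ⟨μ2, h2, rfl⟩, Valu.compatible_skolem.mpr hc,
      Valu.skolem_union ..⟩

lemma eval_image_skolem {N : ℕ} {P : SparqlExpr} (h : P.uriBound ≤ N) (G : Set RDFTriple) :
    eval P (RDFTriple.skolem N '' G) = Valu.skolem N '' eval P G := by
  induction P with
  | pat tp =>
    ext ν
    constructor
    · rintro ⟨hdom, _, ⟨t, ht, rfl⟩, ha⟩
      obtain ⟨μ, rfl⟩ := Valu.exists_skolem_eq hdom ha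
      exact ⟨μ, ⟨Valu.dom_skolem N μ ▸ hdom, t, ht, (TriplePattern.apply_skolem h).mp ha⟩, rfl⟩
    · rintro ⟨μ, ⟨hdom, t, ht, ha⟩, rfl⟩
      exact ⟨(Valu.dom_skolem N μ).trans hdom, _, ⟨t, ht, rfl⟩,
        (TriplePattern.apply_skolem h).mpr ha⟩
  | andE P1 P2 ih1 ih2 =>
    simp only [eval]
    rw [ih1 (le_of_max_le_left h), ih2 (le_of_max_le_right h), image_skolem_join]
  | unionE P1 P2 ih1 ih2 =>
    simp only [eval]
    rw [ih1 (le_of_max_le_left h), ih2 (le_of_max_le_right h), Set.image_union]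
  | optE P1 P2 ih1 ih2 =>
    simp only [eval]
    rw [ih1 (le_of_max_le_left h), ih2 (le_of_max_le_right h), image_skolem_join,
      Set.image_union]
    congr 1
    ext ν
    constructor
    · rintro ⟨⟨μ, hμ, rfl⟩, hn⟩
      exact ⟨μ, ⟨hμ, fun μ2 h2 hc => hn _ ⟨μ2, h2, rfl⟩ (Valu.compatible_skolem.mpr hc)⟩, rfl⟩
    · rintro ⟨μ, ⟨hμ, hn⟩, rfl⟩
      refine ⟨⟨μ, hμ, rfl⟩, ?_⟩
      rintro _ ⟨μ2, h2, rfl⟩ hc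
      exact hn μ2 h2 (Valu.compatible_skolem.mp hc)
  | filterE P R ih =>
    simp only [eval]
    rw [ih (le_of_max_le_left h)]
    ext ν
    constructor
    · rintro ⟨⟨μ, hμ, rfl⟩, hs⟩
      exact ⟨μ, ⟨hμ, (FilterCond.satisfies_skolem (le_of_max_le_right h)).mp hs⟩, rfl⟩
    · rintro ⟨μ, ⟨hμ, hs⟩, rfl⟩
      exact ⟨⟨μ, hμ, rfl⟩, (FilterCond.satisfies_skolem (le_of_max_le_right h)).mpr hs⟩

instance : Countable Term := by
  let f : Term → ℕ ⊕ ℕ ⊕ ℕ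
    | .uri u => .inl u
    | .bnode b => .inr (.inl b)
    | .lit l => .inr (.inr l)
  refine Function.Injective.countable (f := f) ?_
  rintro (a | a | a) (b | b | b) h <;> simp_all [f]

instance : Countable RDFTriple := by
  refine Function.Injective.countable (f := fun t : RDFTriple => (t.s.toTerm, t.p, t.o)) ?_
  rintro ⟨s, p, o⟩ ⟨s', p', o'⟩ h
  simp only [Prod.mk.injEq] at h
  obtain ⟨h1, rfl, rfl⟩ := h
  rw [Node.toTerm_injective h1]

/-- Publish each triple of a set without blank nodes in a document of its own. -/
lemma Web.exists_allData_eq {G : Set RDFTriple} (hG : bnodesOf G = ∅) :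
    ∃ W : Web, W.AllData = G := by
  obtain ⟨e, he⟩ := exists_injective_nat RDFTriple
  refine ⟨{ D := Set.univ
            data := fun d => {t ∈ G | e t = d}
            adoc := some
            data_fin := fun d _ => Set.Subsingleton.finite
              fun t ht t' ht' => he (ht.2.trans ht'.2.symm)
            bnode_disj := fun d _ d' _ _ => Set.disjoint_left.mpr ?_
            adoc_mem := fun _ _ _ => Set.mem_univ _
            adoc_surj := fun d _ => ⟨d, rfl⟩ }, ?_⟩
  · rintro b ⟨t, ht, hb⟩ -
    exact hG.subset ⟨t, ht.1, hb⟩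
  · ext t
    simp [Web.AllData]

/-- Q^P is nontrivially satisfiable iff P is nontrivially satisfiable. -/
theorem statement_1 (P : SparqlExpr) :
    LDQuery.NontriviallySatisfiable (fullWebQuery P) ↔ P.NontriviallySatisfiable := by
  constructor
  · rintro ⟨W, μ, hμ, hdom⟩
    exact ⟨W.AllData, μ, hμ, hdom⟩
  · rintro ⟨G, μ, hμ, hdom⟩
    obtain ⟨W, hW⟩ := Web.exists_allData_eq (bnodesOf_image_skolem P.uriBound G)
    refine ⟨W, μ.skolem P.uriBound, ?_, by rwa [Valu.dom_skolem]⟩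
    rw [fullWebQuery, hW, eval_image_skolem le_rfl]
    exact ⟨μ, hμ, rfl⟩
end

section
/- Let P be a monotonic SPARQL expression, let c be any reachability criterion, and let S ⊂ U be a finite nonempty set of seed URIs. Then the SPARQL_LD(R) query Q^{P,S,c} is monotonic. -/
lemma Reachable.of_inducedSubweb {W1 W2 : Web} (hW : InducedSubweb W1 W2) {S : Set URI}
    {c : ReachCrit} {P : SparqlExpr} {d : Doc} (h : Reachable W1 S c P d) :
    Reachable W2 S c P d := by
  obtain ⟨-, hdata, hadoc⟩ := hW
  induction h with
  | seed hu ha => exact .seed hu ((hadoc _ _).mp ha).1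
  | step hr ht hu hc ha ih =>
    exact .step ih (hdata _ hr.mem_D ▸ ht) hu hc ((hadoc _ _).mp ha).1

lemma allData_reachablePart_subset {W1 W2 : Web} (hW : InducedSubweb W1 W2) (S : Set URI)
    (c : ReachCrit) (P : SparqlExpr) :
    (reachablePart W1 S c P).AllData ⊆ (reachablePart W2 S c P).AllData := by
  intro t ht
  obtain ⟨d, hd, htd⟩ := Set.mem_iUnion₂.mp ht
  refine Set.mem_iUnion₂.mpr ⟨d, Reachable.of_inducedSubweb hW hd, ?_⟩
  have heq : W1.data d = W2.data d := hW.2.1 d (Reachable.mem_D hd)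
  exact heq.subset htd

/-- if P is monotonic then Q^{P,S,c} is monotonic. -/
theorem statement_15 (P : SparqlExpr) (hP : P.Monotonic) (c : ReachCrit)
    (S : Set URI) (hS : S.Finite) (hSne : S.Nonempty) :
    LDQuery.Monotonic (reachQuery P S c) := by
  exact fun W1 W2 hW => hP _ _ (allData_reachablePart_subset hW S c P)
end
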